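/- Let n ≥ 2. A point p ∈ (ℂ ∖ {0})^n is a critical point of the superpotential W if and only if p = p_ξ for some ξ ∈ ℂ with ξ^n = 4, where (p_ξ)_1 = 1 and (p_ξ)_k = ξ^{k−n−1} for 2 ≤ k ≤ n. Moreover, the assignment ξ ↦ p_ξ is injective on the set of n-th roots of 4, so W has exactly n critical points, with respective critical values n·ξ. -/

import Mathlib

open Finset

/-- The superpotential of the monotone Gelfand–Zeitlin torus `Tⁿ_GZ ⊂ Qⁿ` (Y. Kim):
`W(z₁, …, z_n) = 1/z_n + ∑_{k=2}^{n} z_k/z_{k−1} + 2z₂ + z₁z₂`, written in terms of a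
sequence of coordinates `z 1, …, z n`. -/
noncomputable def W (n : ℕ) (z : ℕ → ℂ) : ℂ :=
  1 / z n + (∑ k ∈ Finset.Icc 2 n, z k / z (k - 1)) + 2 * z 2 + z 1 * z 2

/-- Extension of a point `p ∈ ℂⁿ` (with coordinates `p 0, …, p (n−1)` standing for
`z₁, …, z_n`) to a sequence: `ext p k = z_k = p (k−1)` for `1 ≤ k ≤ n`, and `0` otherwise. -/
def ext {n : ℕ} (p : Fin n → ℂ) : ℕ → ℂ :=
  fun k => if h : 1 ≤ k ∧ k ≤ n then p ⟨k - 1, by omega⟩ else 0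

/-- The point `p_ξ ∈ (ℂ∖{0})ⁿ` with `(p_ξ)₁ = 1` and `(p_ξ)_k = ξ^{k−n−1}` for `2 ≤ k ≤ n`
(coordinate `i : Fin n` stands for `z_{i+1}`, so `(p_ξ)_{i+1} = ξ^{i−n}` for `i ≥ 1`). -/
noncomputable def pxi (n : ℕ) (ξ : ℂ) : Fin n → ℂ :=
  fun i => if (i : ℕ) = 0 then 1 else ξ ^ ((i : ℤ) - n)

/-- Padded sequence: `y_{n+1} = 1`. -/
noncomputable def ypad (n : ℕ) (z : ℕ → ℂ) : ℕ → ℂ :=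
  fun k => if k = n + 1 then 1 else z k

/-- Partial derivatives of `W`. -/
noncomputable def DW (n : ℕ) (z : ℕ → ℂ) (j : ℕ) : ℂ :=
  if j = 1 then z 2 - z 2 / z 1 ^ 2
  else if j = 2 then 1 / z 1 + 2 + z 1 - ypad n z 3 / z 2 ^ 2
  else 1 / z (j - 1) - ypad n z (j + 1) / z j ^ 2

lemma ext_update {n : ℕ} (p : Fin n → ℂ) (i : Fin n) (t : ℂ) :
    ext (Function.update p i t) = Function.update (ext p) (i + 1) t := by
  funext k
  have hi := i.2
  by_cases hk : k = i + 1
  · subst hk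
    have : 1 ≤ (i : ℕ) + 1 ∧ (i : ℕ) + 1 ≤ n := by omega
    simp only [_root_.ext, this, Function.update_self]
    simp
  · rw [Function.update_of_ne hk]
    unfold _root_.ext
    split_ifs with h
    · rw [Function.update_of_ne]
      intro h'
      have := congrArg Fin.val h'
      simp at this
      omega
    · rfl

lemma ext_apply {n : ℕ} (p : Fin n → ℂ) (i : Fin n) : ext p (i + 1) = p i := by
  have hi := i.2
  have : 1 ≤ (i : ℕ) + 1 ∧ (i : ℕ) + 1 ≤ n := by omega
  simp [_root_.ext, this]

lemma ext_ne {n : ℕ} (p : Fin n → ℂ) (hp : ∀ i, p i ≠ 0) (k : ℕ) (h1 : 1 ≤ k) (h2 : k ≤ n) :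
    ext p k ≠ 0 := by
  simp [_root_.ext, h1, h2, hp]

lemma hasDeriv_upd (z : ℕ → ℂ) (j k : ℕ) :
    HasDerivAt (fun t : ℂ => Function.update z j t k) (if k = j then 1 else 0) (z j) := by
  by_cases h : k = j
  · subst h
    simpa using hasDerivAt_id' (z k)
  · simpa [h] using hasDerivAt_const (z j) (z k)

lemma hasDeriv_W (n : ℕ) (hn : 2 ≤ n) (z : ℕ → ℂ) (hz : ∀ k, 1 ≤ k → k ≤ n → z k ≠ 0)
    (j : ℕ) (h1 : 1 ≤ j) (h2 : j ≤ n) :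
    HasDerivAt (fun t : ℂ => W n (Function.update z j t)) (DW n z j) (z j) := by
  have e : Function.update z j (z j) = z := Function.update_eq_self j z
  have hd := hasDeriv_upd z j
  have a1 := (hasDerivAt_const (z j) (1 : ℂ)).fun_div (hd n)
    (by rw [e]; exact hz n (by omega) le_rfl)
  have a2 := HasDerivAt.fun_sum (u := Finset.Icc 2 n) (fun k hk => (hd k).fun_div (hd (k - 1))
    (by rw [e]; rw [Finset.mem_Icc] at hk; exact hz _ (by omega) (by omega)))
  have a3 := (hd 2).const_mul (2 : ℂ)
  have a4 := (hd 1).fun_mul (hd 2)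
  have := ((a1.fun_add a2).fun_add a3).fun_add a4
  simp only [e] at this
  refine this.congr_deriv ?_
  have s : (∑ k ∈ Finset.Icc 2 n, ((if k = j then 1 else 0) * z (k - 1) -
      z k * (if k - 1 = j then 1 else 0)) / z (k - 1) ^ 2)
      = (if 2 ≤ j then 1 / z (j - 1) else 0) - (if j + 1 ≤ n then z (j + 1) / z j ^ 2 else 0) := by
    have : ∀ k ∈ Finset.Icc 2 n, ((if k = j then 1 else 0) * z (k - 1) -
      z k * (if k - 1 = j then 1 else 0)) / z (k - 1) ^ 2 =
        (if k = j then 1 / z (j - 1) else 0) - (if k = j + 1 then z (j + 1) / z j ^ 2 else 0) := by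
      intro k hk
      rw [Finset.mem_Icc] at hk
      have hk' := hz (k - 1) (by omega) (by omega)
      by_cases c1 : k = j
      · subst c1
        have : ¬ (k - 1 = k) := by omega
        simp [this]
        field_simp
      · by_cases c2 : k = j + 1
        · subst c2
          simp [neg_div]
        · have : ¬ (k - 1 = j) := by omega
          simp [c1, c2, this]
    rw [Finset.sum_congr rfl this, Finset.sum_sub_distrib, Finset.sum_ite_eq', Finset.sum_ite_eq']
    simp only [Finset.mem_Icc, h2, and_true]
    congr 1
    have : 2 ≤ j + 1 := by omega
    simp [this]
  rw [s]
  have hzj := hz j h1 h2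
  unfold DW ypad
  rcases (show j = 1 ∨ j = 2 ∨ 3 ≤ j by omega) with rfl | rfl | h3
  · have : n ≠ 1 := by omega
    simp [hn, this]
    ring
  · rcases (show n = 2 ∨ 3 ≤ n by omega) with rfl | h
    · simp; ring
    · have e1 : n ≠ 2 := by omega
      have e2 : 2 ≠ n := by omega
      simp [h, e1, e2]; ring
  · have e1 : j ≠ 1 := by omega
    have e2 : j ≠ 2 := by omega
    rcases (show j = n ∨ j + 1 ≤ n by omega) with rfl | h
    · simp [e1, e2, e1.symm, e2.symm, show 2 ≤ j by omega]; ring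
    · simp [e1, e2, e1.symm, e2.symm, show 2 ≤ j by omega, h, show n ≠ j by omega,
        show j ≠ n by omega]

lemma crit_iff (n : ℕ) (hn : 2 ≤ n) (p : Fin n → ℂ) (hp : ∀ i, p i ≠ 0) :
    (∀ i : Fin n, HasDerivAt (fun t : ℂ => W n (ext (Function.update p i t))) 0 (p i)) ↔
      ∀ j, 1 ≤ j → j ≤ n → DW n (ext p) j = 0 := by
  have key : ∀ i : Fin n, HasDerivAt (fun t : ℂ => W n (ext (Function.update p i t)))
      (DW n (ext p) (i + 1)) (p i) := by
    intro i
    have := hasDeriv_W n hn (ext p) (ext_ne p hp) (i + 1) (by omega) (by have := i.2; omega)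
    simpa only [ext_update, ext_apply] using this
  constructor
  · intro h j h1 h2
    have := (key ⟨j - 1, by omega⟩).unique (h _)
    simpa [Nat.sub_add_cancel h1] using this
  · intro h i
    rw [← h (i + 1) (by omega) (by have := i.2; omega)]
    exact key i

lemma root_ne {n : ℕ} (hn : 2 ≤ n) {ξ : ℂ} (h : ξ ^ n = 4) : ξ ≠ 0 := by
  rintro rfl
  rw [zero_pow (by omega)] at h
  norm_num at h

lemma pxi_ne {n : ℕ} (hn : 2 ≤ n) {ξ : ℂ} (h : ξ ^ n = 4) (i : Fin n) : pxi n ξ i ≠ 0 := by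
  unfold pxi
  split_ifs
  · exact one_ne_zero
  · exact zpow_ne_zero _ (root_ne hn h)

lemma ext_pxi_one {n : ℕ} (hn : 2 ≤ n) (ξ : ℂ) : ext (pxi n ξ) 1 = 1 := by
  simp [_root_.ext, pxi, show 1 ≤ n by omega]

lemma ypad_pxi {n : ℕ} (ξ : ℂ) (k : ℕ) (h1 : 2 ≤ k) (h2 : k ≤ n + 1) :
    ypad n (ext (pxi n ξ)) k = ξ ^ ((k : ℤ) - n - 1) := by
  unfold ypad
  split_ifs with h
  · subst h; simp
  · have a : 1 ≤ k ∧ k ≤ n := by omega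
    have b : ¬ (k - 1 = 0) := by omega
    simp only [_root_.ext, pxi, a, b]
    simp [Nat.cast_sub a.1]
    congr 1; ring

lemma ext_pxi {n : ℕ} (ξ : ℂ) (k : ℕ) (h1 : 2 ≤ k) (h2 : k ≤ n) :
    ext (pxi n ξ) k = ξ ^ ((k : ℤ) - n - 1) := by
  rw [← ypad_pxi ξ k h1 (by omega)]
  simp [ypad, show k ≠ n + 1 by omega]

lemma four_mul {n : ℕ} (hn : 2 ≤ n) {ξ : ℂ} (h : ξ ^ n = 4) :
    4 * ξ ^ ((2 : ℤ) - n - 1) = ξ := by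
  have h0 := root_ne hn h
  rw [← h, ← zpow_natCast, ← zpow_add₀ h0]
  rw [show (n : ℤ) + (2 - n - 1) = 1 by ring, zpow_one]

lemma DW_pxi {n : ℕ} (hn : 2 ≤ n) {ξ : ℂ} (h : ξ ^ n = 4) (j : ℕ) (h1 : 1 ≤ j) (h2 : j ≤ n) :
    DW n (ext (pxi n ξ)) j = 0 := by
  have h0 := root_ne hn h
  unfold DW
  split_ifs with c1 c2
  · rw [ext_pxi_one hn]; simp
  · rw [ext_pxi_one hn, ypad_pxi ξ 3 (by omega) (by omega), ext_pxi ξ 2 le_rfl hn]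
    have f := four_mul hn h
    have g : ξ ^ (((3 : ℕ) : ℤ) - n - 1) = ξ * ξ ^ ((2 : ℤ) - n - 1) := by
      rw [← zpow_one_add₀ h0]; congr 1; push_cast; ring
    have hne : ξ ^ ((2 : ℤ) - n - 1) ≠ 0 := zpow_ne_zero _ h0
    rw [g]
    push_cast
    generalize ξ ^ ((2 : ℤ) - n - 1) = a at *
    field_simp
    linear_combination f
  · rw [ypad_pxi ξ (j + 1) (by omega) (by omega), ext_pxi ξ j (by omega) h2,
      ext_pxi ξ (j - 1) (by omega) (by omega), sub_eq_zero, ← zpow_natCast, ← zpow_mul,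
      ← zpow_sub₀ h0, one_div, ← zpow_neg]
    congr 1
    rw [Nat.cast_sub h1]
    push_cast
    ring

lemma crit_forward {n : ℕ} (hn : 2 ≤ n) (p : Fin n → ℂ) (hp : ∀ i, p i ≠ 0)
    (hD : ∀ j, 1 ≤ j → j ≤ n → DW n (ext p) j = 0) : ∃ ξ : ℂ, ξ ^ n = 4 ∧ p = pxi n ξ := by
  set z := ext p with hzdef
  have hz : ∀ k, 1 ≤ k → k ≤ n → z k ≠ 0 := ext_ne p hp
  set y := ypad n z with hy
  have hyz : ∀ k, k ≤ n → y k = z k := by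
    intro k hk
    simp [hy, ypad, show k ≠ n + 1 by omega]
  have hy1 : y (n + 1) = 1 := by simp [hy, ypad]
  have hyn : ∀ k, 1 ≤ k → k ≤ n + 1 → y k ≠ 0 := by
    intro k h1 h2
    rcases (show k = n + 1 ∨ k ≤ n by omega) with rfl | h
    · rw [hy1]; exact one_ne_zero
    · rw [hyz k h]; exact hz k h1 h
  have z1 := hz 1 le_rfl (by omega)
  have z2 := hz 2 (by omega) hn
  have e1 := hD 1 le_rfl (by omega)
  have e2 := hD 2 (by omega) hn
  have y3 := hyn 3 (by omega) (by omega)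
  simp only [DW, if_true, show (2 : ℕ) ≠ 1 by norm_num, if_false] at e1 e2
  rw [← hy] at e2
  have sq : (z 1 - 1) * (z 1 + 1) = 0 := by
    field_simp at e1
    apply mul_left_cancel₀ z2
    linear_combination e1
  have hz1 : z 1 = 1 := by
    rcases mul_eq_zero.1 sq with h | h
    · linear_combination h
    · exfalso
      have h' : z 1 = -1 := by linear_combination h
      rw [h'] at e2
      have : y 3 / z 2 ^ 2 = 0 := by linear_combination -e2
      exact div_ne_zero y3 (pow_ne_zero 2 z2) this
  have hy3 : y 3 = 4 * z 2 * z 2 := by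
    rw [hz1] at e2
    field_simp at e2
    linear_combination -e2
  obtain ⟨ξ, hξ⟩ : ∃ ξ : ℂ, ξ = 4 * z 2 := ⟨_, rfl⟩
  have h0 : ξ ≠ 0 := by rw [hξ]; exact mul_ne_zero (by norm_num) z2
  have step : ∀ k, 2 ≤ k → k ≤ n → y (k + 1) = ξ * y k := by
    intro k hk
    induction k, hk using Nat.le_induction with
    | base => intro _; rw [hyz 2 hn, hy3, hξ]
    | succ k hk ih =>
      intro hkn
      have ih := ih (by omega)
      have e := hD (k + 1) (by omega) hkn
      simp only [DW, show k + 1 ≠ 1 by omega, show k + 1 ≠ 2 by omega, if_false,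
        Nat.add_sub_cancel] at e
      rw [← hy, ← hyz k (by omega), ← hyz (k + 1) hkn] at e
      have n1 := hyn k (by omega) (by omega)
      have n2 := hyn (k + 1) (by omega) (by omega)
      field_simp at e
      apply mul_left_cancel₀ n1
      rw [ih] at e ⊢
      linear_combination -e
  have form : ∀ k, 2 ≤ k → k ≤ n + 1 → y k = ξ ^ (k - 2) * z 2 := by
    intro k hk
    induction k, hk using Nat.le_induction with
    | base => intro _; rw [hyz 2 hn]; simp
    | succ k hk ih =>
      intro hkn
      rw [step k hk (by omega), ih (by omega), show k + 1 - 2 = (k - 2) + 1 by omega, pow_succ]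
      ring
  have hlast : ξ ^ (n - 1) * z 2 = 1 := by
    rw [← hy1, form (n + 1) (by omega) le_rfl]
    rfl
  have hroot : ξ ^ n = 4 := by
    rw [show n = (n - 1) + 1 by omega, pow_succ]
    nth_rewrite 2 [hξ]
    linear_combination 4 * hlast
  refine ⟨ξ, hroot, ?_⟩
  have hz2 : z 2 = ξ ^ ((2 : ℤ) - n - 1) := by
    have f := four_mul hn hroot
    rw [hξ] at f ⊢
    linear_combination -f / 4
  funext i
  have hi := i.2
  rw [← ext_apply p i, ← ext_apply (pxi n ξ) i, ← hzdef]
  rcases (show (i : ℕ) = 0 ∨ 1 ≤ (i : ℕ) by omega) with h | h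
  · rw [h, zero_add, hz1, ext_pxi_one hn]
  · rw [ext_pxi ξ _ (by omega) (by omega), ← hyz _ (by omega), form _ (by omega) (by omega), hz2,
      ← zpow_natCast, ← zpow_add₀ h0, Nat.cast_sub (by omega)]
    congr 1
    push_cast
    ring

lemma pxi_inj {n : ℕ} (hn : 2 ≤ n) (ξ ξ' : ℂ) (h : ξ ^ n = 4) (h' : ξ' ^ n = 4)
    (e : pxi n ξ = pxi n ξ') : ξ = ξ' := by
  have e2 := congrArg (fun p => ext p 2) e
  simp only [ext_pxi _ 2 le_rfl hn] at e2
  rw [← four_mul hn h, ← four_mul hn h']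
  push_cast at e2
  rw [e2]

lemma card_roots {n : ℕ} (hn : 2 ≤ n) : {ξ : ℂ | ξ ^ n = 4}.ncard = n := by
  have hp := Complex.isPrimitiveRoot_exp n (by omega)
  have hs : {ξ : ℂ | ξ ^ n = 4} = ((Polynomial.nthRoots n (4 : ℂ)).toFinset : Set ℂ) := by
    ext ξ
    simp [Polynomial.mem_nthRoots (show 0 < n by omega)]
  rw [hs, Set.ncard_coe_finset, Multiset.toFinset_card_of_nodup
    (hp.nthRoots_nodup (by norm_num)), hp.card_nthRoots, if_pos]
  exact IsAlgClosed.exists_pow_nat_eq 4 (by omega)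

lemma W_pxi {n : ℕ} (hn : 2 ≤ n) {ξ : ℂ} (h : ξ ^ n = 4) : W n (ext (pxi n ξ)) = n * ξ := by
  have h0 := root_ne hn h
  have f := four_mul hn h
  unfold W
  have hI : Finset.Icc 2 n = insert 2 (Finset.Icc 3 n) := by
    ext k; simp only [Finset.mem_insert, Finset.mem_Icc]; omega
  have s : ∑ k ∈ Finset.Icc 3 n, ext (pxi n ξ) k / ext (pxi n ξ) (k - 1) = ((n : ℂ) - 2) * ξ := by
    have : ∀ k ∈ Finset.Icc 3 n, ext (pxi n ξ) k / ext (pxi n ξ) (k - 1) = ξ := by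
      intro k hk
      rw [Finset.mem_Icc] at hk
      rw [ext_pxi ξ k (by omega) (by omega), ext_pxi ξ (k - 1) (by omega) (by omega),
        ← zpow_sub₀ h0, Nat.cast_sub (by omega)]
      convert zpow_one ξ using 2
      push_cast
      ring
    rw [Finset.sum_congr rfl this, Finset.sum_const, Nat.card_Icc, nsmul_eq_mul,
      show n + 1 - 3 = n - 2 by omega, Nat.cast_sub hn]
    norm_num
  rw [hI, Finset.sum_insert (by simp), s]
  simp only [show 2 - 1 = 1 from rfl]
  rw [ext_pxi_one hn, ext_pxi ξ 2 le_rfl hn, ext_pxi ξ n hn le_rfl]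
  have g : (1 : ℂ) / ξ ^ ((n : ℤ) - n - 1) = ξ := by
    rw [show (n : ℤ) - n - 1 = -1 by ring]
    simp
  rw [g]
  push_cast
  linear_combination f

/-- Classification of the critical points of the superpotential `W` of `Tⁿ_GZ`:
a point `p ∈ (ℂ∖{0})ⁿ` is a critical point of `W` iff `p = p_ξ` for some `n`-th root `ξ`
of `4`; the map `ξ ↦ p_ξ` is injective on such roots; hence `W` has exactly `n` critical
points, with respective critical values `n·ξ`. -/
theorem superpotential_critical_points (n : ℕ) (hn : 2 ≤ n) :
    (∀ p : Fin n → ℂ, (∀ i, p i ≠ 0) →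
      ((∀ i : Fin n,
          HasDerivAt (fun t : ℂ => W n (ext (Function.update p i t))) 0 (p i)) ↔
        ∃ ξ : ℂ, ξ ^ n = 4 ∧ p = pxi n ξ)) ∧
    (∀ ξ ξ' : ℂ, ξ ^ n = 4 → ξ' ^ n = 4 → pxi n ξ = pxi n ξ' → ξ = ξ') ∧
    ({p : Fin n → ℂ | (∀ i, p i ≠ 0) ∧
        ∀ i : Fin n,
          HasDerivAt (fun t : ℂ => W n (ext (Function.update p i t))) 0 (p i)}.ncard = n) ∧
    (∀ ξ : ℂ, ξ ^ n = 4 → W n (ext (pxi n ξ)) = n * ξ) := by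
  have main : ∀ p : Fin n → ℂ, (∀ i, p i ≠ 0) →
      ((∀ i : Fin n,
          HasDerivAt (fun t : ℂ => W n (ext (Function.update p i t))) 0 (p i)) ↔
        ∃ ξ : ℂ, ξ ^ n = 4 ∧ p = pxi n ξ) := by
    intro p hp
    rw [crit_iff n hn p hp]
    constructor
    · exact crit_forward hn p hp
    · rintro ⟨ξ, h, rfl⟩ j h1 h2
      exact DW_pxi hn h j h1 h2
  refine ⟨main, pxi_inj hn, ?_, fun ξ h => W_pxi hn h⟩
  have hset : {p : Fin n → ℂ | (∀ i, p i ≠ 0) ∧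
        ∀ i : Fin n,
          HasDerivAt (fun t : ℂ => W n (ext (Function.update p i t))) 0 (p i)}
      = pxi n '' {ξ : ℂ | ξ ^ n = 4} := by
    ext p
    simp only [Set.mem_ofPred_eq, Set.mem_image]
    constructor
    · rintro ⟨hp, hd⟩
      obtain ⟨ξ, h, e⟩ := (main p hp).1 hd
      exact ⟨ξ, h, e.symm⟩
    · rintro ⟨ξ, h, rfl⟩
      exact ⟨pxi_ne hn h, (main _ (pxi_ne hn h)).2 ⟨ξ, h, rfl⟩⟩
  have hinj : Set.InjOn (pxi n) {ξ : ℂ | ξ ^ n = 4} :=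
    fun ξ h ξ' h' e => pxi_inj hn ξ ξ' h h' e
  rw [hset, hinj.ncard_image, card_roots hn]
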